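/- Let n = 2 and d = (2,2). For all m_1, m_2, j ∈ ℕ, the dimension of the ℂ-vector space of polynomials f ∈ R of multidegree (m_1,m_2) with D1(f) = 0 and E(f) = j·f equals the coefficient of z_1^{m_1} z_2^{m_2} t^{j} in the formal power series (1 + z_1 z_2 t²)·((1 − z_1 t²)(1 − z_2 t²)(1 − z_1²)(1 − z_2²)(1 − z_1 z_2))^{−1} ∈ ℤ[[z_1,z_2,t]]; i.e., the multivariate Poincaré series of the algebra of joint covariants of two binary quadratic forms equals (1 + z_1 z_2 t²)/((1 − z_1 t²)(1 − z_2 t²)(1 − z_1²)(1 − z_2²)(1 − z_1 z_2)). -/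

import Mathlib

open MvPolynomial

/-- Index type for the variables `v^{(k)}_j`, `1 ≤ k ≤ n`, `0 ≤ j ≤ d k`. -/
abbrev Idx (n : ℕ) (d : Fin n → ℕ) := Σ k : Fin n, Fin (d k + 1)

/-- The derivation `D1` with `D1 (v^{(k)}_j) = j • v^{(k)}_{j-1}`. -/
noncomputable def D1 (n : ℕ) (d : Fin n → ℕ) :
    Derivation ℂ (MvPolynomial (Idx n d) ℂ) (MvPolynomial (Idx n d) ℂ) :=
  mkDerivation ℂ (fun x =>
    if h : x.2.1 = 0 then 0
    else (x.2.1 : ℂ) • X ⟨x.1, ⟨x.2.1 - 1, by have := x.2.isLt; omega⟩⟩)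

/-- The derivation `D2` with `D2 (v^{(k)}_j) = (d k - j) • v^{(k)}_{j+1}`. -/
noncomputable def D2 (n : ℕ) (d : Fin n → ℕ) :
    Derivation ℂ (MvPolynomial (Idx n d) ℂ) (MvPolynomial (Idx n d) ℂ) :=
  mkDerivation ℂ (fun x =>
    if h : x.2.1 = d x.1 then 0
    else ((d x.1 - x.2.1 : ℕ) : ℂ) • X ⟨x.1, ⟨x.2.1 + 1, by have := x.2.isLt; omega⟩⟩)

/-- The derivation `E` with `E (v^{(k)}_j) = (d k - 2 j) • v^{(k)}_j`. -/
noncomputable def E (n : ℕ) (d : Fin n → ℕ) :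
    Derivation ℂ (MvPolynomial (Idx n d) ℂ) (MvPolynomial (Idx n d) ℂ) :=
  mkDerivation ℂ (fun x => ((d x.1 : ℂ) - 2 * (x.2.1 : ℂ)) • X x)

/-- The subspace of polynomials of multidegree `m`: every monomial has total degree
`m k` in the variables `v^{(k)}_0, …, v^{(k)}_{d k}`, for each `k`. -/
noncomputable def mdeg (n : ℕ) (d : Fin n → ℕ) (m : Fin n → ℕ) :
    Submodule ℂ (MvPolynomial (Idx n d) ℂ) where
  carrier := {f | ∀ α ∈ f.support, ∀ k : Fin n,
    (∑ j : Fin (d k + 1), α ⟨k, j⟩) = m k}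
  add_mem' := by
    intro f g hf hg α hα k
    rcases Finset.mem_union.mp (MvPolynomial.support_add hα) with h | h
    · exact hf α h k
    · exact hg α h k
  zero_mem' := by
    intro α hα k
    simp at hα
  smul_mem' := by
    intro c f hf α hα k
    exact hf α (MvPolynomial.support_smul hα) k

/-- `ω_d(m; i)`: the number of families of nonnegative integers
`(α^{(k)}_j)` with `∑_j α^{(k)}_j = m k` for each `k` and
`∑_{k,j} (d k - 2 j) ⬝ α^{(k)}_j = i`. -/
noncomputable def omegaCount (n : ℕ) (d : Fin n → ℕ) (m : Fin n → ℕ) (i : ℤ) : ℕ :=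
  Nat.card {α : Idx n d → ℕ //
    (∀ k : Fin n, (∑ j : Fin (d k + 1), α ⟨k, j⟩) = m k) ∧
    (∑ k : Fin n, ∑ j : Fin (d k + 1),
      ((d k : ℤ) - 2 * (j : ℕ)) * (α ⟨k, j⟩ : ℤ)) = i}


section Diag

variable {σ : Type*} [Fintype σ]

/-- diagonal derivation -/
noncomputable def diagDer (c : σ → ℂ) :
    Derivation ℂ (MvPolynomial σ ℂ) (MvPolynomial σ ℂ) :=
  mkDerivation ℂ (fun x => c x • X x)

lemma diagDer_monomial (c : σ → ℂ) (α : σ →₀ ℕ) (r : ℂ) :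
    diagDer c (monomial α r) = (∑ x, (α x : ℂ) * c x) • monomial α r := by
  rw [diagDer, mkDerivation_monomial, Finsupp.sum_fintype _ _ (by simp), Finset.sum_smul,
    Finset.smul_sum]
  refine Finset.sum_congr rfl fun x _ => ?_
  by_cases h : α x = 0
  · simp [h]
  · have h1 : Finsupp.single x 1 ≤ α := by
      rw [Finsupp.single_le_iff]; omega
    have : monomial (α - Finsupp.single x 1) ((α x : ℂ)) * X x = monomial α (α x : ℂ) := by
      rw [X, monomial_mul, tsub_add_cancel_of_le h1, mul_one]
    rw [smul_eq_mul, mul_smul_comm, this, smul_monomial, smul_monomial, smul_monomial]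
    congr 1
    simp only [smul_eq_mul]; ring

lemma coeff_diagDer (c : σ → ℂ) (α : σ →₀ ℕ) (f : MvPolynomial σ ℂ) :
    coeff α (diagDer c f) = (∑ x, (α x : ℂ) * c x) * coeff α f := by
  induction f using MvPolynomial.induction_on' with
  | monomial β r =>
    classical
    rw [diagDer_monomial, coeff_smul, coeff_monomial, smul_eq_mul]
    split_ifs with h
    · rw [h]
    · simp
  | add p q hp hq => rw [map_add, coeff_add, coeff_add, hp, hq]; ring

lemma diagDer_eigen_iff (c : σ → ℂ) (w : ℂ) (f : MvPolynomial σ ℂ) :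
    diagDer c f = w • f ↔ ∀ α ∈ f.support, ∑ x, (α x : ℂ) * c x = w := by
  constructor
  · intro h α hα
    have := congrArg (coeff α) h
    rw [coeff_diagDer, coeff_smul, smul_eq_mul] at this
    exact mul_right_cancel₀ (mem_support_iff.mp hα) this
  · intro h
    ext α
    rw [coeff_diagDer, coeff_smul, smul_eq_mul]
    by_cases hα : α ∈ f.support
    · rw [h α hα]
    · rw [notMem_support_iff.mp hα]; simp

end Diag

section Gen

variable (n : ℕ) (d : Fin n → ℕ)

noncomputable def eul (k : Fin n) := diagDer (σ := Idx n d) (fun x => if x.1 = k then 1 else 0)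

lemma E_eq : E n d = diagDer (fun x => ((d x.1 : ℂ) - 2 * (x.2.1 : ℂ))) := rfl

lemma mem_mdeg_iff (m : Fin n → ℕ) (f : MvPolynomial (Idx n d) ℂ) :
    f ∈ mdeg n d m ↔ ∀ k, eul n d k f = (m k : ℂ) • f := by
  have : ∀ (α : Idx n d →₀ ℕ) (k : Fin n),
      ∑ x, (α x : ℂ) * (if x.1 = k then 1 else 0) = ((∑ j : Fin (d k + 1), α ⟨k, j⟩ : ℕ) : ℂ) := by
    intro α k
    rw [Fintype.sum_sigma, Finset.sum_eq_single k]
    · simp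
    · intro b _ hb; simp [hb]
    · simp
  simp only [eul, diagDer_eigen_iff, this, Nat.cast_inj]
  exact ⟨fun h k α hα => h α hα k, fun h α hα k => h k α hα⟩

lemma D1_X0 (k : Fin n) (h : 0 < d k + 1) : D1 n d (X ⟨k, ⟨0, h⟩⟩) = 0 := by
  simp [D1, mkDerivation_X]

lemma D1_Xs (k : Fin n) (i : ℕ) (h : i + 1 < d k + 1) :
    D1 n d (X ⟨k, ⟨i + 1, h⟩⟩) = ((i + 1 : ℕ) : ℂ) • X ⟨k, ⟨i, by omega⟩⟩ := by
  simp [D1, mkDerivation_X]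

lemma D2_Xd (k : Fin n) (j : ℕ) (h : j < d k + 1) (hj : j = d k) :
    D2 n d (X ⟨k, ⟨j, h⟩⟩) = 0 := by
  simp [D2, mkDerivation_X, hj]

lemma D2_Xs (k : Fin n) (j : ℕ) (h : j < d k + 1) (hj : j < d k) :
    D2 n d (X ⟨k, ⟨j, h⟩⟩) = ((d k : ℂ) - j) • X ⟨k, ⟨j + 1, by omega⟩⟩ := by
  simp [D2, mkDerivation_X, hj.ne, Nat.cast_sub hj.le]

lemma E_X (k : Fin n) (j : ℕ) (h : j < d k + 1) :
    E n d (X ⟨k, ⟨j, h⟩⟩) = ((d k : ℂ) - 2 * j) • X ⟨k, ⟨j, h⟩⟩ := by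
  rw [E, mkDerivation_X]

lemma eul_X (k k' : Fin n) (j : ℕ) (h : j < d k' + 1) :
    eul n d k (X ⟨k', ⟨j, h⟩⟩) = (if k' = k then 1 else 0 : ℂ) • X ⟨k', ⟨j, h⟩⟩ := by
  rw [eul, diagDer, mkDerivation_X]

lemma comm_E_D1 : ⁅E n d, D1 n d⁆ = (2 : ℂ) • D1 n d := by
  apply derivation_ext
  rintro ⟨k, j, hj⟩
  rw [Derivation.commutator_apply, Derivation.smul_apply, E_X, Derivation.map_smul]
  rcases j with _ | i
  · rw [D1_X0]; simp
  · rw [D1_Xs, Derivation.map_smul, E_X, smul_smul, smul_smul, smul_smul, ← sub_smul]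
    congr 1; push_cast; ring

lemma comm_E_D2 : ⁅E n d, D2 n d⁆ = (-2 : ℂ) • D2 n d := by
  apply derivation_ext
  rintro ⟨k, j, hj⟩
  rw [Derivation.commutator_apply, Derivation.smul_apply, E_X, Derivation.map_smul]
  by_cases h : j = d k
  · simp [D2_Xd n d k j hj h]
  · rw [D2_Xs n d k j hj (by omega), Derivation.map_smul, E_X, smul_smul, smul_smul, smul_smul,
      ← sub_smul]
    congr 1; push_cast; ring

lemma comm_eul_D1 (k : Fin n) : ⁅eul n d k, D1 n d⁆ = 0 := by
  apply derivation_ext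
  rintro ⟨k', j, hj⟩
  rw [Derivation.commutator_apply, Derivation.zero_apply, eul_X, Derivation.map_smul]
  rcases j with _ | i
  · rw [D1_X0]; simp
  · rw [D1_Xs, Derivation.map_smul, eul_X, smul_smul, smul_smul, mul_comm, sub_self]

lemma comm_eul_D2 (k : Fin n) : ⁅eul n d k, D2 n d⁆ = 0 := by
  apply derivation_ext
  rintro ⟨k', j, hj⟩
  rw [Derivation.commutator_apply, Derivation.zero_apply, eul_X, Derivation.map_smul]
  by_cases h : j = d k'
  · simp [D2_Xd n d k' j hj h]
  · rw [D2_Xs n d k' j hj (by omega), Derivation.map_smul, eul_X, smul_smul, smul_smul, mul_comm,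
      sub_self]

lemma comm_D1_D2 : ⁅D1 n d, D2 n d⁆ = E n d := by
  apply derivation_ext
  rintro ⟨k, j, hj⟩
  rw [Derivation.commutator_apply, E_X]
  have hA : D1 n d (D2 n d (X ⟨k, ⟨j, hj⟩⟩)) =
      (((d k : ℂ) - j) * (j + 1)) • X ⟨k, ⟨j, hj⟩⟩ := by
    by_cases h : j = d k
    · rw [D2_Xd n d k j hj h]; simp [h]
    · rw [D2_Xs n d k j hj (by omega), Derivation.map_smul, D1_Xs, smul_smul]; push_cast; rfl
  have hB : D2 n d (D1 n d (X ⟨k, ⟨j, hj⟩⟩)) =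
      ((j : ℂ) * (d k - j + 1)) • X ⟨k, ⟨j, hj⟩⟩ := by
    rcases j with _ | i
    · rw [D1_X0]; simp
    · rw [D1_Xs, Derivation.map_smul, D2_Xs n d k i (by omega) (by omega), smul_smul]
      congr 1; push_cast; ring
  rw [hA, hB, ← sub_smul]
  congr 1; ring

variable (m : Fin n → ℕ)

noncomputable def W (w : ℂ) : Submodule ℂ (MvPolynomial (Idx n d) ℂ) :=
  mdeg n d m ⊓ Module.End.eigenspace (E n d).toLinearMap w

lemma mem_W (w : ℂ) (f) : f ∈ W n d m w ↔ (∀ k, eul n d k f = (m k : ℂ) • f) ∧ E n d f = w • f := by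
  rw [W, Submodule.mem_inf, mem_mdeg_iff, Module.End.mem_eigenspace_iff]; rfl

lemma D1_mem (w : ℂ) (f) (hf : f ∈ W n d m w) : D1 n d f ∈ W n d m (w + 2) := by
  rw [mem_W] at *
  refine ⟨fun k => ?_, ?_⟩
  · have := DFunLike.congr_fun (comm_eul_D1 n d k) f
    rw [Derivation.commutator_apply, hf.1 k, Derivation.map_smul, Derivation.zero_apply] at this
    exact sub_eq_zero.mp this
  · have := DFunLike.congr_fun (comm_E_D1 n d) f
    rw [Derivation.commutator_apply, hf.2, Derivation.map_smul, Derivation.smul_apply] at this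
    rw [sub_eq_iff_eq_add.mp this, add_smul, add_comm]

lemma D2_mem (w : ℂ) (f) (hf : f ∈ W n d m w) : D2 n d f ∈ W n d m (w - 2) := by
  rw [mem_W] at *
  refine ⟨fun k => ?_, ?_⟩
  · have := DFunLike.congr_fun (comm_eul_D2 n d k) f
    rw [Derivation.commutator_apply, hf.1 k, Derivation.map_smul, Derivation.zero_apply] at this
    exact sub_eq_zero.mp this
  · have := DFunLike.congr_fun (comm_E_D2 n d) f
    rw [Derivation.commutator_apply, hf.2, Derivation.map_smul, Derivation.smul_apply] at this
    rw [sub_eq_iff_eq_add.mp this, ← add_smul]; congr 1; ring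

/-- exponents occurring in `W` -/
def expSet (w : ℤ) : Set (Idx n d →₀ ℕ) :=
  {α | (∀ k : Fin n, (∑ j : Fin (d k + 1), α ⟨k, j⟩) = m k) ∧
    ∑ x : Idx n d, (α x : ℤ) * ((d x.1 : ℤ) - 2 * (x.2.1 : ℤ)) = w}

lemma W_eq (w : ℤ) : W n d m w = restrictSupport ℂ (expSet n d m w) := by
  ext f
  rw [W, Submodule.mem_inf, Module.End.mem_eigenspace_iff, mem_restrictSupport_iff]
  have h2 : (E n d).toLinearMap f = (w : ℂ) • f ↔ ∀ α ∈ f.support,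
      ∑ x : Idx n d, (α x : ℤ) * ((d x.1 : ℤ) - 2 * (x.2.1 : ℤ)) = w := by
    have := diagDer_eigen_iff (fun x : Idx n d => ((d x.1 : ℂ) - 2 * (x.2.1 : ℂ))) w f
    refine Iff.trans this ?_
    refine forall₂_congr fun α _ => ?_
    rw [← Int.cast_inj (α := ℂ)]
    push_cast
    rfl
  rw [h2]
  constructor
  · rintro ⟨h, h'⟩ α hα
    exact ⟨h α hα, h' α hα⟩
  · intro h
    exact ⟨fun α hα => (h hα).1, fun α hα => (h hα).2⟩

lemma finrank_W (w : ℤ) : Module.finrank ℂ (W n d m w) = Nat.card (expSet n d m w) := by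
  rw [W_eq]
  exact Module.finrank_eq_nat_card_basis (basisRestrictSupport ℂ (expSet n d m w))

lemma le_of_mem {α : Idx n d →₀ ℕ} (h : ∀ k : Fin n, (∑ j : Fin (d k + 1), α ⟨k, j⟩) = m k)
    (x : Idx n d) : α x ≤ m x.1 := by
  rw [← h x.1]
  exact Finset.single_le_sum (f := fun j => α ⟨x.1, j⟩) (fun _ _ => Nat.zero_le _)
    (Finset.mem_univ x.2)

lemma finite_expSet (w : ℤ) : (expSet n d m w).Finite := by
  refine Set.Finite.subset (Set.finite_Iic (Finsupp.equivFunOnFinite.symm fun x => m x.1)) ?_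
  intro α hα x
  exact le_of_mem n d m hα.1 x

instance (w : ℤ) : Module.Finite ℂ (W n d m w) := by
  rw [W_eq]
  have := (finite_expSet n d m w).to_subtype
  exact Module.Finite.of_basis (basisRestrictSupport ℂ (expSet n d m w))

lemma W_bot (w : ℤ) (hw : ∑ x : Idx n d, (m x.1 : ℤ) * d x.1 < w) : W n d m w = ⊥ := by
  rw [W_eq, eq_bot_iff]
  intro f hf
  rw [mem_restrictSupport_iff] at hf
  rw [Submodule.mem_bot, ← support_eq_empty, Finset.eq_empty_iff_forall_notMem]
  intro α hα
  have := hf hα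
  have h2 : ∑ x : Idx n d, (α x : ℤ) * ((d x.1 : ℤ) - 2 * (x.2.1 : ℤ)) ≤
      ∑ x : Idx n d, (m x.1 : ℤ) * d x.1 := by
    refine Finset.sum_le_sum fun x _ => ?_
    have h3 := le_of_mem n d m this.1 x
    have h4 : (α x : ℤ) ≤ m x.1 := by exact_mod_cast h3
    have : (α x : ℤ) * d x.1 ≤ m x.1 * d x.1 := by gcongr
    have : 0 ≤ (α x : ℤ) * (2 * (x.2.1 : ℤ)) := by positivity
    linarith
  rw [this.2] at h2
  omega

lemma D1_iter_mem (w : ℤ) (f) (hf : f ∈ W n d m w) (N : ℕ) :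
    (D1 n d)^[N] f ∈ W n d m ((w + 2 * N : ℤ) : ℂ) := by
  induction N with
  | zero => simpa using hf
  | succ N ih =>
    rw [Function.iterate_succ_apply']
    convert D1_mem n d m _ _ ih using 1
    push_cast; ring

lemma ef_inj (k : ℤ) (hk : 1 ≤ k) (u) (hu : u ∈ W n d m k) (h : D1 n d (D2 n d u) = 0) :
    u = 0 := by
  have comm : ∀ v, D1 n d (D2 n d v) - D2 n d (D1 n d v) = E n d v := by
    intro v
    rw [← comm_D1_D2, Derivation.commutator_apply]
  have key : ∀ N : ℕ, ∃ c : ℤ, 0 < c ∧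
      D2 n d ((D1 n d)^[N+1] u) = (-c : ℂ) • (D1 n d)^[N] u := by
    intro N
    induction N with
    | zero =>
      refine ⟨k, by omega, ?_⟩
      have := comm u
      rw [h, ((mem_W n d m _ _).mp hu).2] at this
      simp only [zero_add, Function.iterate_one, Function.iterate_zero, id]
      rw [neg_smul, ← this]; simp
    | succ N ih =>
      obtain ⟨c, hc, hN⟩ := ih
      refine ⟨c + (k + 2 * (N + 1 : ℕ)), by positivity, ?_⟩
      have h1 := comm ((D1 n d)^[N+1] u)
      rw [hN, ((mem_W n d m _ _).mp (D1_iter_mem n d m k u hu (N+1))).2, Derivation.map_smul,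
        ← Function.iterate_succ_apply' (D1 n d), ← Function.iterate_succ_apply' (D1 n d)] at h1
      rw [sub_eq_iff_eq_add] at h1
      have h2 := eq_sub_of_add_eq' h1.symm
      rw [h2, ← sub_smul]
      congr 1; push_cast; ring
  have down : ∀ N : ℕ, (D1 n d)^[N] u = 0 → u = 0 := by
    intro N
    induction N with
    | zero => exact id
    | succ N ih =>
      intro h
      obtain ⟨c, hc, hN⟩ := key N
      rw [h, map_zero] at hN
      refine ih ((smul_eq_zero.mp hN.symm).resolve_left ?_)
      have : (c : ℂ) ≠ 0 := by exact_mod_cast hc.ne'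
      simpa using this
  set B := ∑ x : Idx n d, (m x.1 : ℤ) * d x.1 with hB
  have hB0 : 0 ≤ B := by positivity
  refine down (B.toNat + 1) ?_
  have := D1_iter_mem n d m k u hu (B.toNat + 1)
  rw [W_bot] at this
  · exact this
  · push_cast; rw [Int.toNat_of_nonneg hB0, ← hB]; linarith

/-- `D1` restricted. -/
noncomputable def D1r (w : ℤ) : W n d m w →ₗ[ℂ] W n d m ((w + 2 : ℤ) : ℂ) :=
  (D1 n d).toLinearMap.restrict (fun f hf => by
    have := D1_mem n d m _ _ hf
    push_cast; exact this)

noncomputable def D2r (w : ℤ) : W n d m ((w + 2 : ℤ) : ℂ) →ₗ[ℂ] W n d m w :=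
  (D2 n d).toLinearMap.restrict (fun f hf => by
    have := D2_mem n d m _ _ hf
    push_cast at this; rwa [add_sub_cancel_right] at this)

lemma D1r_surj (w : ℤ) (hw : 0 ≤ w) : Function.Surjective (D1r n d m w) := by
  have hinj : Function.Injective (D1r n d m w ∘ₗ D2r n d m w) := by
    rw [← LinearMap.ker_eq_bot, LinearMap.ker_eq_bot']
    intro u hu
    apply Subtype.ext
    refine ef_inj n d m (w + 2) (by omega) u.1 u.2 ?_
    exact congrArg Subtype.val hu
  have := LinearMap.surjective_of_injective hinj
  rw [LinearMap.coe_comp] at this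
  exact this.of_comp

lemma finrank_main (w : ℤ) (hw : 0 ≤ w) :
    (Module.finrank ℂ ↥(mdeg n d m ⊓ LinearMap.ker (D1 n d).toLinearMap ⊓
        Module.End.eigenspace ((E n d).toLinearMap) (w : ℂ)) : ℤ) =
      Nat.card (expSet n d m w) - Nat.card (expSet n d m (w + 2)) := by
  rw [← finrank_W, ← finrank_W]
  have h1 := LinearMap.finrank_range_add_finrank_ker (D1r n d m w)
  rw [LinearMap.range_eq_top.mpr (D1r_surj n d m w hw), finrank_top] at h1
  have h2 : Module.finrank ℂ (LinearMap.ker (D1r n d m w)) =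
      Module.finrank ℂ ↥(mdeg n d m ⊓ LinearMap.ker (D1 n d).toLinearMap ⊓
        Module.End.eigenspace ((E n d).toLinearMap) (w : ℂ)) := by
    rw [← Submodule.finrank_map_subtype_eq]
    have : (LinearMap.ker (D1r n d m w)).map (W n d m w).subtype =
        mdeg n d m ⊓ LinearMap.ker (D1 n d).toLinearMap ⊓
        Module.End.eigenspace ((E n d).toLinearMap) (w : ℂ) := by
      ext f
      simp only [Submodule.mem_map, LinearMap.mem_ker, Submodule.mem_inf, Submodule.subtype_apply]
      constructor
      · rintro ⟨g, hg, rfl⟩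
        exact ⟨⟨g.2.1, congrArg Subtype.val hg⟩, g.2.2⟩
      · rintro ⟨⟨h1, h2⟩, h3⟩
        exact ⟨⟨f, h1, h3⟩, Subtype.ext h2, rfl⟩
    rw [this]
  rw [← h2, ← h1]; push_cast; ring

end Gen

section Count

/-- bounding box -/
def box (m₁ m₂ : ℕ) : Finset (ℕ × ℕ × ℕ × ℕ) :=
  Finset.range (m₁ + 1) ×ˢ Finset.range (m₁ + 1) ×ˢ Finset.range (m₂ + 1) ×ˢ Finset.range (m₂ + 1)

def T (m₁ m₂ : ℕ) (w : ℤ) : Finset (ℕ × ℕ × ℕ × ℕ) :=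
  (box m₁ m₂).filter fun q => q.1 + q.2.1 ≤ m₁ ∧ q.2.2.1 + q.2.2.2 ≤ m₂ ∧
    2 * ((q.1 : ℤ) - q.2.1 + q.2.2.1 - q.2.2.2) = w

def T1 (m₁ m₂ : ℕ) (w : ℤ) : Finset (ℕ × ℕ × ℕ × ℕ) :=
  (T m₁ m₂ w).filter fun q => q.1 = 0 ∨ q.2.1 = 0

def T2 (m₁ m₂ : ℕ) (w : ℤ) : Finset (ℕ × ℕ × ℕ × ℕ) :=
  (T1 m₁ m₂ w).filter fun q => q.2.2.1 = 0 ∨ q.2.2.2 = 0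

lemma mem_T {m₁ m₂ : ℕ} {w : ℤ} {a b c e : ℕ} : (a, b, c, e) ∈ T m₁ m₂ w ↔
    a + b ≤ m₁ ∧ c + e ≤ m₂ ∧ 2 * ((a : ℤ) - b + c - e) = w := by
  simp only [T, box, Finset.mem_filter, Finset.mem_product, Finset.mem_range]
  omega

lemma mem_T1 {m₁ m₂ : ℕ} {w : ℤ} {a b c e : ℕ} : (a, b, c, e) ∈ T1 m₁ m₂ w ↔
    a + b ≤ m₁ ∧ c + e ≤ m₂ ∧ 2 * ((a : ℤ) - b + c - e) = w ∧ (a = 0 ∨ b = 0) := by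
  rw [T1, Finset.mem_filter, mem_T]; tauto

lemma mem_T2 {m₁ m₂ : ℕ} {w : ℤ} {a b c e : ℕ} : (a, b, c, e) ∈ T2 m₁ m₂ w ↔
    a + b ≤ m₁ ∧ c + e ≤ m₂ ∧ 2 * ((a : ℤ) - b + c - e) = w ∧ (a = 0 ∨ b = 0) ∧
      (c = 0 ∨ e = 0) := by
  rw [T2, Finset.mem_filter, mem_T1]; tauto

lemma card_T (m₁ m₂ : ℕ) (w : ℤ) : ((T m₁ m₂ w).card : ℤ) -
    (if 2 ≤ m₁ then ((T (m₁ - 2) m₂ w).card : ℤ) else 0) = (T1 m₁ m₂ w).card := by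
  have h := Finset.card_filter_add_card_filter_not (s := T m₁ m₂ w) (fun q => q.1 = 0 ∨ q.2.1 = 0)
  have h2 : ((T m₁ m₂ w).filter fun q => ¬ (q.1 = 0 ∨ q.2.1 = 0)).card =
      if 2 ≤ m₁ then (T (m₁ - 2) m₂ w).card else 0 := by
    split_ifs with hm
    · symm
      refine Finset.card_bij (fun q _ => (q.1 + 1, q.2.1 + 1, q.2.2)) ?_ ?_ ?_
      · rintro ⟨a, b, c, e⟩ hq
        rw [mem_T] at hq
        simp only [Finset.mem_filter, mem_T]
        omega
      · rintro ⟨a, b, c, e⟩ _ ⟨a', b', c', e'⟩ _ h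
        simp only [Prod.mk.injEq] at h ⊢
        omega
      · rintro ⟨a, b, c, e⟩ hq
        simp only [Finset.mem_filter, mem_T] at hq
        refine ⟨(a - 1, b - 1, c, e), ?_, ?_⟩
        · rw [mem_T]; omega
        · simp only [Prod.mk.injEq, true_and, and_true]; omega
    · rw [Finset.card_eq_zero, Finset.eq_empty_iff_forall_notMem]
      rintro ⟨a, b, c, e⟩ hq
      simp only [Finset.mem_filter, mem_T] at hq
      omega
  rw [h2] at h
  rw [T1, ← h]
  push_cast
  ring

lemma card_T1 (m₁ m₂ : ℕ) (w : ℤ) : ((T1 m₁ m₂ w).card : ℤ) -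
    (if 2 ≤ m₂ then ((T1 m₁ (m₂ - 2) w).card : ℤ) else 0) = (T2 m₁ m₂ w).card := by
  have h := Finset.card_filter_add_card_filter_not (s := T1 m₁ m₂ w)
    (fun q => q.2.2.1 = 0 ∨ q.2.2.2 = 0)
  have h2 : ((T1 m₁ m₂ w).filter fun q => ¬ (q.2.2.1 = 0 ∨ q.2.2.2 = 0)).card =
      if 2 ≤ m₂ then (T1 m₁ (m₂ - 2) w).card else 0 := by
    split_ifs with hm
    · symm
      refine Finset.card_bij (fun q _ => (q.1, q.2.1, q.2.2.1 + 1, q.2.2.2 + 1)) ?_ ?_ ?_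
      · rintro ⟨a, b, c, e⟩ hq
        rw [mem_T1] at hq
        simp only [Finset.mem_filter, mem_T1]
        omega
      · rintro ⟨a, b, c, e⟩ _ ⟨a', b', c', e'⟩ _ h
        simp only [Prod.mk.injEq] at h ⊢
        omega
      · rintro ⟨a, b, c, e⟩ hq
        simp only [Finset.mem_filter, mem_T1] at hq
        refine ⟨(a, b, c - 1, e - 1), ?_, ?_⟩
        · rw [mem_T1]; omega
        · simp only [Prod.mk.injEq, true_and, and_true]; omega
    · rw [Finset.card_eq_zero, Finset.eq_empty_iff_forall_notMem]
      rintro ⟨a, b, c, e⟩ hq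
      simp only [Finset.mem_filter, mem_T1] at hq
      omega
  rw [h2] at h
  rw [T2, ← h]
  push_cast
  ring

lemma card_T2_even (m₁ m₂ : ℕ) (s : ℤ) : (T2 m₁ m₂ (2 * s)).card =
    (Finset.Icc (max (-(m₁ : ℤ)) (s - m₂)) (min (m₁ : ℤ) (s + m₂))).card := by
  refine Finset.card_bij (fun q _ => (q.1 : ℤ) - q.2.1) ?_ ?_ ?_
  · rintro ⟨a, b, c, e⟩ hq
    rw [mem_T2] at hq
    simp only [Finset.mem_Icc]
    omega
  · rintro ⟨a, b, c, e⟩ hq ⟨a', b', c', e'⟩ hq' h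
    rw [mem_T2] at hq hq'
    simp only [Prod.mk.injEq] at h ⊢
    omega
  · intro x hx
    rw [Finset.mem_Icc] at hx
    refine ⟨(x.toNat, (-x).toNat, (s - x).toNat, (x - s).toNat), ?_, ?_⟩
    · rw [mem_T2]; omega
    · simp only; omega

lemma card_T2_odd (m₁ m₂ : ℕ) (w : ℤ) (hw : ¬ 2 ∣ w) : (T2 m₁ m₂ w).card = 0 := by
  rw [Finset.card_eq_zero, Finset.eq_empty_iff_forall_notMem]
  rintro ⟨a, b, c, e⟩ hq
  rw [mem_T2] at hq
  omega

/-- successive coefficient functions -/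
def g0 (x y z : ℕ) : ℤ := (T x y z).card - (T x y (z + 2)).card
def g1 (x y z : ℕ) : ℤ := (T1 x y z).card - (T1 x y (z + 2)).card
def g2 (x y z : ℕ) : ℤ :=
  if 2 ∣ z ∧ 2 * x ≤ 2 * y + z ∧ 2 * y ≤ 2 * x + z ∧ z ≤ 2 * (x + y) then 1 else 0
def g3 (x y z : ℕ) : ℤ :=
  if z = 2 * (x + y) ∨ (1 ≤ x ∧ 1 ≤ y ∧ z + 2 = 2 * (x + y)) then 1 else 0
def g4 (x y z : ℕ) : ℤ :=
  if (x = 0 ∧ z = 2 * y) ∨ (x = 1 ∧ 1 ≤ y ∧ z = 2 * y) then 1 else 0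
def g5 (x y z : ℕ) : ℤ :=
  if (x = 0 ∧ y = 0 ∧ z = 0) ∨ (x = 1 ∧ y = 1 ∧ z = 2) then 1 else 0

def mulF (a b c : ℕ) (g : ℕ → ℕ → ℕ → ℤ) (x y z : ℕ) : ℤ :=
  g x y z - if a ≤ x ∧ b ≤ y ∧ c ≤ z then g (x - a) (y - b) (z - c) else 0

lemma mulF_g0 : mulF 2 0 0 g0 = g1 := by
  funext x y z
  simp only [mulF, g0, g1, ← card_T, Nat.zero_le, and_true, Nat.sub_zero]
  split_ifs <;> ring

lemma mulF_g1 : mulF 0 2 0 g1 = g2 := by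
  funext x y z
  have : mulF 0 2 0 g1 x y z = (T2 x y z).card - (T2 x y (z + 2)).card := by
    simp only [mulF, g1, ← card_T1, Nat.zero_le, and_true, true_and, Nat.sub_zero]
    split_ifs <;> ring
  rw [this, g2]
  by_cases hz : 2 ∣ z
  · obtain ⟨s, rfl⟩ := hz
    have h1 : ((2 * s : ℕ) : ℤ) = 2 * (s : ℤ) := by push_cast; ring
    have h2 : ((2 * s : ℕ) : ℤ) + 2 = 2 * ((s : ℤ) + 1) := by push_cast; ring
    rw [h2, h1, card_T2_even, card_T2_even, Int.card_Icc, Int.card_Icc]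
    split_ifs <;> omega
  · rw [card_T2_odd _ _ _ (by omega), card_T2_odd _ _ _ (by omega), if_neg (by tauto)]
    simp

lemma mulF_g2 : mulF 1 1 0 g2 = g3 := by
  funext x y z
  simp only [mulF, g2, g3]
  split_ifs <;> omega

lemma mulF_g3 : mulF 1 0 2 g3 = g4 := by
  funext x y z
  simp only [mulF, g3, g4]
  split_ifs <;> omega

lemma mulF_g4 : mulF 0 1 2 g4 = g5 := by
  funext x y z
  simp only [mulF, g4, g5]
  split_ifs <;> omega

end Count

section Series

abbrev V3 := Fin 2 ⊕ Unit

noncomputable def mk3 (a b c : ℕ) : V3 →₀ ℕ :=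
  Finsupp.equivFunOnFinite.symm (Sum.elim ![a, b] fun _ => c)

lemma mk3_0 (a b c : ℕ) : mk3 a b c (Sum.inl 0) = a := rfl
lemma mk3_1 (a b c : ℕ) : mk3 a b c (Sum.inl 1) = b := rfl
lemma mk3_2 (a b c : ℕ) : mk3 a b c (Sum.inr ()) = c := rfl

lemma mk3_ext (n n' : V3 →₀ ℕ) (h0 : n (Sum.inl 0) = n' (Sum.inl 0))
    (h1 : n (Sum.inl 1) = n' (Sum.inl 1)) (h2 : n (Sum.inr ()) = n' (Sum.inr ())) : n = n' := by
  ext x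
  rcases x with x | x
  · fin_cases x
    · exact h0
    · exact h1
  · exact h2

lemma mk3_le (a b c : ℕ) (n : V3 →₀ ℕ) : mk3 a b c ≤ n ↔
    a ≤ n (Sum.inl 0) ∧ b ≤ n (Sum.inl 1) ∧ c ≤ n (Sum.inr ()) := by
  constructor
  · intro h; exact ⟨h (Sum.inl 0), h (Sum.inl 1), h (Sum.inr ())⟩
  · rintro ⟨h0, h1, h2⟩ x
    rcases x with x | x
    · fin_cases x
      · exact h0
      · exact h1
    · exact h2

noncomputable def ser (g : ℕ → ℕ → ℕ → ℤ) : MvPowerSeries V3 ℤ :=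
  fun n => g (n (Sum.inl 0)) (n (Sum.inl 1)) (n (Sum.inr ()))

lemma coeff_ser (g : ℕ → ℕ → ℕ → ℤ) (n : V3 →₀ ℕ) : MvPowerSeries.coeff n (ser g) =
    g (n (Sum.inl 0)) (n (Sum.inl 1)) (n (Sum.inr ())) := rfl

noncomputable def mon (a b c : ℕ) : MvPowerSeries V3 ℤ := MvPowerSeries.monomial (mk3 a b c) 1

lemma ser_mul (a b c : ℕ) (g : ℕ → ℕ → ℕ → ℤ) :
    ser g * (1 - mon a b c) = ser (mulF a b c g) := by
  ext n
  rw [mul_sub, mul_one, map_sub, coeff_ser, coeff_ser, mon, MvPowerSeries.coeff_mul_monomial,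
    mulF]
  simp only [mk3_le, mul_one, coeff_ser, Finsupp.tsub_apply, mk3_0, mk3_1, mk3_2]

lemma mon_mul (a b c a' b' c' : ℕ) : mon a b c * mon a' b' c' = mon (a + a') (b + b') (c + c') := by
  rw [mon, mon, mon, MvPowerSeries.monomial_mul_monomial, mul_one]
  congr 2
  apply mk3_ext <;> rfl

lemma X0_eq : (MvPowerSeries.X (Sum.inl 0) : MvPowerSeries V3 ℤ) = mon 1 0 0 := by
  rw [mon, MvPowerSeries.X]; congr 2; apply mk3_ext <;> simp [mk3_0, mk3_1, mk3_2]

lemma X1_eq : (MvPowerSeries.X (Sum.inl 1) : MvPowerSeries V3 ℤ) = mon 0 1 0 := by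
  rw [mon, MvPowerSeries.X]; congr 2; apply mk3_ext <;> simp [mk3_0, mk3_1, mk3_2]

lemma X2_eq : (MvPowerSeries.X (Sum.inr ()) : MvPowerSeries V3 ℤ) = mon 0 0 1 := by
  rw [mon, MvPowerSeries.X]; congr 2; apply mk3_ext <;> simp [mk3_0, mk3_1, mk3_2]

lemma g5_eq : ser g5 = 1 + mon 1 1 2 := by
  ext n
  have h1 : (1 : MvPowerSeries V3 ℤ) = mon 0 0 0 := by
    rw [mon, ← MvPowerSeries.monomial_zero_one]; congr 2; apply mk3_ext <;> rfl
  have h2 : ∀ a b c, n = mk3 a b c ↔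
    n (Sum.inl 0) = a ∧ n (Sum.inl 1) = b ∧ n (Sum.inr ()) = c := by
    intro a b c
    constructor
    · rintro rfl; exact ⟨rfl, rfl, rfl⟩
    · rintro ⟨h0, h1, h2⟩; exact mk3_ext _ _ h0 h1 h2
  rw [h1, map_add, mon, mon, MvPowerSeries.coeff_monomial, MvPowerSeries.coeff_monomial, coeff_ser]
  simp only [h2, g5]
  split_ifs <;> omega

lemma series_eq : ((1 + MvPowerSeries.X (Sum.inl 0 : Fin 2 ⊕ Unit) *
            MvPowerSeries.X (Sum.inl 1) * MvPowerSeries.X (Sum.inr ()) ^ 2) *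
         MvPowerSeries.invOfUnit
          ((1 - MvPowerSeries.X (Sum.inl 0 : Fin 2 ⊕ Unit) *
              MvPowerSeries.X (Sum.inr ()) ^ 2) *
           (1 - MvPowerSeries.X (Sum.inl 1 : Fin 2 ⊕ Unit) *
              MvPowerSeries.X (Sum.inr ()) ^ 2) *
           (1 - MvPowerSeries.X (Sum.inl 0 : Fin 2 ⊕ Unit) ^ 2) *
           (1 - MvPowerSeries.X (Sum.inl 1 : Fin 2 ⊕ Unit) ^ 2) *
           (1 - MvPowerSeries.X (Sum.inl 0 : Fin 2 ⊕ Unit) *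
              MvPowerSeries.X (Sum.inl 1))) 1 : MvPowerSeries V3 ℤ) = ser g0 := by
  set Den : MvPowerSeries V3 ℤ := _ * _ * _ * _ * _ with hDen
  have hc : MvPowerSeries.constantCoeff Den = ((1 : ℤˣ) : ℤ) := by
    simp [hDen]
  have hF : ser g0 * Den = 1 + MvPowerSeries.X (Sum.inl 0 : Fin 2 ⊕ Unit) *
            MvPowerSeries.X (Sum.inl 1) * MvPowerSeries.X (Sum.inr ()) ^ 2 := by
    rw [hDen]
    simp only [X0_eq, X1_eq, X2_eq, pow_two, mon_mul, zero_add, add_zero, one_add_one_eq_two]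
    rw [← g5_eq, ← mulF_g4, ← mulF_g3, ← mulF_g2, ← mulF_g1, ← mulF_g0]
    simp only [← ser_mul]
    ring
  rw [← hF, mul_assoc, MvPowerSeries.mul_invOfUnit _ _ hc, mul_one]

end Series

lemma card_expSet (m₁ m₂ : ℕ) (w : ℤ) :
    Nat.card (expSet 2 ![2, 2] ![m₁, m₂] w) = (T m₁ m₂ w).card := by
  rw [← Nat.card_eq_finsetCard]
  have key : ∀ α : Idx 2 ![2, 2] →₀ ℕ, α ∈ expSet 2 ![2, 2] ![m₁, m₂] w ↔
      (α ⟨0, (0 : Fin 3)⟩ + α ⟨0, (1 : Fin 3)⟩ + α ⟨0, (2 : Fin 3)⟩ = m₁ ∧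
       α ⟨1, (0 : Fin 3)⟩ + α ⟨1, (1 : Fin 3)⟩ + α ⟨1, (2 : Fin 3)⟩ = m₂) ∧
      2 * ((α ⟨0, (0 : Fin 3)⟩ : ℤ) - α ⟨0, (2 : Fin 3)⟩ +
        α ⟨1, (0 : Fin 3)⟩ - α ⟨1, (2 : Fin 3)⟩) = w := by
    intro α
    have h0 : (∑ j : Fin (![2, 2] (0 : Fin 2) + 1), α ⟨0, j⟩) =
      α ⟨0, (0 : Fin 3)⟩ + α ⟨0, (1 : Fin 3)⟩ + α ⟨0, (2 : Fin 3)⟩ :=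
      Fin.sum_univ_three (fun j : Fin 3 => α ⟨0, j⟩)
    have h1 : (∑ j : Fin (![2, 2] (1 : Fin 2) + 1), α ⟨1, j⟩) =
      α ⟨1, (0 : Fin 3)⟩ + α ⟨1, (1 : Fin 3)⟩ + α ⟨1, (2 : Fin 3)⟩ :=
      Fin.sum_univ_three (fun j : Fin 3 => α ⟨1, j⟩)
    have h2 : ∑ x : Idx 2 ![2, 2], (α x : ℤ) * (((![2, 2] x.1 : ℕ) : ℤ) - 2 * (x.2.1 : ℤ)) =
        2 * ((α ⟨0, (0 : Fin 3)⟩ : ℤ) - α ⟨0, (2 : Fin 3)⟩ +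
        α ⟨1, (0 : Fin 3)⟩ - α ⟨1, (2 : Fin 3)⟩) := by
      rw [Fintype.sum_sigma, Fin.sum_univ_two]
      have e0 := Fin.sum_univ_three
        (fun j : Fin 3 => (α ⟨0, j⟩ : ℤ) * (((2 : ℕ) : ℤ) - 2 * (j.1 : ℤ)))
      have e1 := Fin.sum_univ_three
        (fun j : Fin 3 => (α ⟨1, j⟩ : ℤ) * (((2 : ℕ) : ℤ) - 2 * (j.1 : ℤ)))
      refine (congrArg₂ (· + ·) e0 e1).trans ?_
      simp
      ring
    rw [expSet, Set.mem_ofPred_eq, Fin.forall_fin_two, h0, h1, h2]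
    rfl
  refine Nat.card_eq_of_bijective
    (fun α => ⟨(α.1 ⟨0, (0 : Fin 3)⟩, α.1 ⟨0, (2 : Fin 3)⟩, α.1 ⟨1, (0 : Fin 3)⟩,
      α.1 ⟨1, (2 : Fin 3)⟩), ?_⟩) ⟨?_, ?_⟩
  · have := (key α.1).mp α.2
    rw [mem_T]; omega
  · rintro ⟨α, hα⟩ ⟨β, hβ⟩ h
    rw [key] at hα hβ
    simp only [Subtype.mk.injEq, Prod.mk.injEq] at h
    apply Subtype.ext
    ext ⟨k, i⟩
    change α _ = β _
    fin_cases k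
    · change Fin 3 at i
      fin_cases i
      · exact h.1
      · change α ⟨0, (1 : Fin 3)⟩ = β ⟨0, (1 : Fin 3)⟩
        omega
      · exact h.2.1
    · change Fin 3 at i
      fin_cases i
      · exact h.2.2.1
      · change α ⟨1, (1 : Fin 3)⟩ = β ⟨1, (1 : Fin 3)⟩
        omega
      · exact h.2.2.2
  · rintro ⟨⟨a, b, c, e⟩, h⟩
    rw [mem_T] at h
    refine ⟨⟨Finsupp.equivFunOnFinite.symm (fun x : Idx 2 ![2, 2] =>
      if x.1 = 0 then (if x.2.1 = 0 then a else if x.2.1 = 1 then m₁ - a - b else b)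
      else (if x.2.1 = 0 then c else if x.2.1 = 1 then m₂ - c - e else e)), ?_⟩, ?_⟩
    · rw [key]
      change (a + (m₁ - a - b) + b = m₁ ∧ c + (m₂ - c - e) + e = m₂) ∧
        2 * ((a : ℤ) - b + c - e) = w
      omega
    · rfl

/-- The multivariate Poincaré series of the algebra of joint covariants of two binary
quadratic forms is
`(1 + z₁z₂t²) / ((1 - z₁t²)(1 - z₂t²)(1 - z₁²)(1 - z₂²)(1 - z₁z₂))`: for `d = (2,2)`,
the dimension of the space of multidegree-`(m₁, m₂)` polynomials with `D1 f = 0` and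
`E f = j • f` equals the coefficient of `z₁^{m₁} z₂^{m₂} t^j` in that series.  The
power-series variables are indexed by `Fin 2 ⊕ Unit`, with `Sum.inl 0 ↦ z₁`,
`Sum.inl 1 ↦ z₂`, `Sum.inr () ↦ t`; the denominator has constant term `1`, hence is
invertible. -/
theorem poincare_series_covariants_d22 (m₁ m₂ j : ℕ) :
    (Module.finrank ℂ ↥(mdeg 2 ![2, 2] ![m₁, m₂] ⊓
        LinearMap.ker (D1 2 ![2, 2]).toLinearMap ⊓
        Module.End.eigenspace ((E 2 ![2, 2]).toLinearMap) (j : ℂ)) : ℤ) =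
      MvPowerSeries.coeff (R := ℤ)
        (Finsupp.equivFunOnFinite.symm (Sum.elim ![m₁, m₂] fun _ => j))
        ((1 + MvPowerSeries.X (Sum.inl 0 : Fin 2 ⊕ Unit) *
            MvPowerSeries.X (Sum.inl 1) * MvPowerSeries.X (Sum.inr ()) ^ 2) *
         MvPowerSeries.invOfUnit
          ((1 - MvPowerSeries.X (Sum.inl 0 : Fin 2 ⊕ Unit) *
              MvPowerSeries.X (Sum.inr ()) ^ 2) *
           (1 - MvPowerSeries.X (Sum.inl 1 : Fin 2 ⊕ Unit) *
              MvPowerSeries.X (Sum.inr ()) ^ 2) *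
           (1 - MvPowerSeries.X (Sum.inl 0 : Fin 2 ⊕ Unit) ^ 2) *
           (1 - MvPowerSeries.X (Sum.inl 1 : Fin 2 ⊕ Unit) ^ 2) *
           (1 - MvPowerSeries.X (Sum.inl 0 : Fin 2 ⊕ Unit) *
              MvPowerSeries.X (Sum.inl 1))) 1) := by
  rw [series_eq]
  have h := finrank_main 2 ![2, 2] ![m₁, m₂] (j : ℤ) (by positivity)
  rw [card_expSet, card_expSet, Int.cast_natCast] at h
  exact h
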